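/- arXiv:2509.06821 — 6 statements merged into one kernel-verified Lean document; each statement's English description precedes it below -/
import Mathlib

section
/- Let n ≥ 1 be an integer, let θ ∈ ℝ^{n+1} be a unit vector, and let ξ ∈ ℝ^{n+1} be nonzero with ⟨ξ, θ⟩ = 0. Then the derivative of the curve t ↦ γ(t, ξ, θ) = θ + (tθ + ξ)/(t² + ‖ξ‖²) at t = −1/2 is a positive scalar multiple of γ(−1/2, ξ, θ); precisely, γ'(−1/2, ξ, θ) = (4/(1 + 4‖ξ‖²)) · γ(−1/2, ξ, θ). Since ‖γ(−1/2, ξ, θ)‖ = 1, the curve meets the unit sphere radially, i.e. orthogonally, at t = −1/2. -/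
open scoped RealInnerProductSpace

/-- The curve `γ(t, ξ, θ) = θ + (tθ + ξ)/(t² + ‖ξ‖²)`. -/
noncomputable def gammaCurve {n : ℕ} (t : ℝ) (ξ θ : EuclideanSpace ℝ (Fin (n + 1))) :
    EuclideanSpace ℝ (Fin (n + 1)) :=
  θ + (t ^ 2 + ‖ξ‖ ^ 2)⁻¹ • (t • θ + ξ)

/-- At `t = -1/2` the derivative of the curve is the positive multiple
`(4/(1+4‖ξ‖²)) γ(-1/2,ξ,θ)` of the position vector, which is a unit vector:
the curve meets the unit sphere radially (hence orthogonally). -/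
theorem stmt_3 (n : ℕ) (hn : 1 ≤ n)
    (θ ξ : EuclideanSpace ℝ (Fin (n + 1)))
    (hθ : ‖θ‖ = 1) (hξ : ξ ≠ 0) (horth : ⟪ξ, θ⟫ = 0) :
    HasDerivAt (fun s : ℝ => gammaCurve s ξ θ)
      ((4 / (1 + 4 * ‖ξ‖ ^ 2)) • gammaCurve (-(1 / 2)) ξ θ) (-(1 / 2)) ∧
    0 < 4 / (1 + 4 * ‖ξ‖ ^ 2) ∧
    ‖gammaCurve (-(1 / 2)) ξ θ‖ = 1 := by
  have hD : (0 : ℝ) < 1 + 4 * ‖ξ‖ ^ 2 := by positivity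
  have hD' : (0 : ℝ) < (-(1 / 2)) ^ 2 + ‖ξ‖ ^ 2 := by positivity
  have hinv : ((-(1 / 2) : ℝ) ^ 2 + ‖ξ‖ ^ 2)⁻¹ = 4 / (1 + 4 * ‖ξ‖ ^ 2) := by
    rw [inv_eq_one_div, div_eq_div_iff hD'.ne' hD.ne']
    ring
  refine ⟨?_, by positivity, ?_⟩
  · have hden : HasDerivAt (fun s : ℝ => (s ^ 2 + ‖ξ‖ ^ 2)⁻¹)
        ((4 / (1 + 4 * ‖ξ‖ ^ 2)) ^ 2) (-(1 / 2)) := by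
      refine (((hasDerivAt_pow 2 (-(1 / 2) : ℝ)).add_const (‖ξ‖ ^ 2)).fun_inv hD'.ne').congr_deriv ?_
      rw [← hinv, inv_pow]
      norm_num
    have hnum : HasDerivAt (fun s : ℝ => s • θ + ξ) θ (-(1 / 2)) := by
      simpa using ((hasDerivAt_id (-(1 / 2) : ℝ)).smul_const θ).add_const ξ
    unfold gammaCurve
    refine ((hden.fun_smul hnum).const_add θ).congr_deriv ?_
    rw [hinv]
    module
  · have hnorm : ‖gammaCurve (-(1 / 2)) ξ θ‖ ^ 2 = 1 := by
      have hγ : gammaCurve (-(1 / 2)) ξ θ =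
          (4 / (1 + 4 * ‖ξ‖ ^ 2)) • ξ + (1 - 2 / (1 + 4 * ‖ξ‖ ^ 2)) • θ := by
        rw [gammaCurve, hinv]
        module
      rw [hγ, norm_add_sq_real, real_inner_smul_left, real_inner_smul_right, horth,
        norm_smul, norm_smul, mul_pow, mul_pow, hθ, Real.norm_eq_abs, Real.norm_eq_abs,
        sq_abs, sq_abs]
      field_simp
      ring
    exact (pow_eq_one_iff_of_nonneg (norm_nonneg _) two_ne_zero).mp hnorm
end

section
/- For every real m > 1 there exists a constant C_m > 0 such that for all r ≥ 0 one has ∫_{−∞}^{−1/2} |1 + 2t|^{m−1}/(t² + r²)^m dt ≤ C_m (1 + r)^{−m}. -/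
open MeasureTheory Set Filter in
theorem integral_Ioi_add_rpow_of_lt {a c b : ℝ} (ha : a < -1) (hc : -b < c) :
    ∫ x in Ioi c, (x + b) ^ a = -(c + b) ^ (a + 1) / (a + 1) := by
  have hd : ∀ x ∈ Ici c, HasDerivAt (fun t ↦ (t + b) ^ (a + 1) / (a + 1)) ((x + b) ^ a) x := by
    intro x hx
    have hpos : x + b ≠ 0 := by linarith [mem_Ici.mp hx]
    have ha1 : a + 1 ≠ 0 := by linarith
    convert! ((((hasDerivAt_id x).add_const b).rpow_const
      (p := a + 1) (Or.inl hpos)).div_const (a + 1)) using 1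
    simp [ha1]
  have ht : Tendsto (fun t ↦ (t + b) ^ (a + 1) / (a + 1)) atTop (nhds (0 / (a + 1))) := by
    rw [← neg_neg (a + 1)]
    exact (tendsto_rpow_neg_atTop (by linarith)).comp
      (tendsto_atTop_add_const_right _ b tendsto_id) |>.div_const _
  rw [integral_Ioi_of_hasDerivAt_of_tendsto' hd (integrableOn_add_rpow_Ioi_of_lt ha hc) ht]
  ring

theorem abs_one_sub_two_mul_rpow_div_le {m r u : ℝ} (hm : 1 < m) (hr : 0 ≤ r) (hu : 1 / 2 < u) :
    |1 - 2 * u| ^ (m - 1) / (u ^ 2 + r ^ 2) ^ m ≤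
      2 ^ (m - 1) * 2 ^ m * (u + r) ^ (-m - 1) := by
  have hs : 0 < u + r := by linarith
  have hnum : |1 - 2 * u| ^ (m - 1) ≤ (2 * (u + r)) ^ (m - 1) := by
    apply Real.rpow_le_rpow (abs_nonneg _) _ (by linarith)
    rw [abs_le]
    constructor <;> linarith
  have hden : ((u + r) * (u + r) / 2) ^ m ≤ (u ^ 2 + r ^ 2) ^ m := by
    apply Real.rpow_le_rpow (by positivity) _ (by linarith)
    nlinarith [sq_nonneg (u - r)]
  calc |1 - 2 * u| ^ (m - 1) / (u ^ 2 + r ^ 2) ^ m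
      ≤ (2 * (u + r)) ^ (m - 1) / ((u + r) * (u + r) / 2) ^ m := by gcongr
    _ = 2 ^ (m - 1) * 2 ^ m * (u + r) ^ (-m - 1) := by
      rw [Real.div_rpow (by positivity) (by norm_num), Real.mul_rpow hs.le hs.le,
        Real.mul_rpow (by norm_num) hs.le, Real.rpow_sub_one hs.ne', Real.rpow_sub_one hs.ne',
        Real.rpow_neg hs.le]
      have := Real.rpow_pos_of_pos hs m
      field_simp

open MeasureTheory Set in
/-- For `m > 1` there is `C_m > 0` such that
`∫_{-∞}^{-1/2} |1+2t|^{m-1}/(t²+r²)^m dt ≤ C_m (1+r)^{-m}` for all `r ≥ 0`. -/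
theorem stmt_7 (m : ℝ) (hm : 1 < m) :
    ∃ C : ℝ, 0 < C ∧ ∀ r : ℝ, 0 ≤ r →
      (∫ t in Set.Iio (-(1 / 2) : ℝ), |1 + 2 * t| ^ (m - 1) / (t ^ 2 + r ^ 2) ^ m) ≤
        C * (1 + r) ^ (-m) := by
  have hm0 : 0 < m := by linarith
  refine ⟨2 ^ (m - 1) * 2 ^ m * (2 ^ m / m), by positivity, fun r hr ↦ ?_⟩
  have hreflect : (∫ t in Iio (-(1 / 2) : ℝ), |1 + 2 * t| ^ (m - 1) / (t ^ 2 + r ^ 2) ^ m) =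
      ∫ u in Ioi (1 / 2 : ℝ), |1 - 2 * u| ^ (m - 1) / (u ^ 2 + r ^ 2) ^ m := by
    have h := integral_comp_neg_Iic (-(1 / 2) : ℝ)
      (fun u : ℝ ↦ |1 - 2 * u| ^ (m - 1) / (u ^ 2 + r ^ 2) ^ m)
    rw [neg_neg] at h
    rw [← h, integral_Iic_eq_integral_Iio]
    simp only [mul_neg, sub_neg_eq_add, neg_sq]
  have hint : IntegrableOn (fun u : ℝ ↦ (u + r) ^ (-m - 1)) (Ioi (1 / 2)) :=
    integrableOn_add_rpow_Ioi_of_lt (by linarith) (by linarith)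
  have hhalf : (1 / 2 + r) ^ (-m) ≤ 2 ^ m * (1 + r) ^ (-m) :=
    calc (1 / 2 + r) ^ (-m) ≤ ((1 + r) / 2) ^ (-m) :=
          Real.rpow_le_rpow_of_nonpos (by positivity) (by linarith) (by linarith)
      _ = 2 ^ m * (1 + r) ^ (-m) := by
          rw [Real.div_rpow (by positivity) (by norm_num), Real.rpow_neg (by norm_num : (0:ℝ) ≤ 2),
            div_inv_eq_mul, mul_comm]
  rw [hreflect]
  calc ∫ u in Ioi (1 / 2 : ℝ), |1 - 2 * u| ^ (m - 1) / (u ^ 2 + r ^ 2) ^ m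
      ≤ ∫ u in Ioi (1 / 2 : ℝ), 2 ^ (m - 1) * 2 ^ m * (u + r) ^ (-m - 1) := by
        refine integral_mono_of_nonneg (.of_forall fun u ↦ by positivity)
          (hint.const_mul _) ?_
        filter_upwards [ae_restrict_mem measurableSet_Ioi] with u hu
        exact abs_one_sub_two_mul_rpow_div_le hm hr hu
    _ = 2 ^ (m - 1) * 2 ^ m * ((1 / 2 + r) ^ (-m) / m) := by
        rw [integral_const_mul, integral_Ioi_add_rpow_of_lt (by linarith) (by linarith),
          sub_add_cancel, neg_div_neg_eq]
    _ ≤ 2 ^ (m - 1) * 2 ^ m * (2 ^ m * (1 + r) ^ (-m) / m) := by gcongr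
    _ = 2 ^ (m - 1) * 2 ^ m * (2 ^ m / m) * (1 + r) ^ (-m) := by ring
end

section
/- Let n ≥ 1 be an integer and m > 1 a real number. There exists a constant C_m > 0 with the following property: if U : ℝ^{n+1} → ℝ is measurable, vanishes outside the open unit ball, and satisfies ‖U‖_{∞,m} := sup_{‖w‖<1} ((1+‖w‖)/(1−‖w‖))^m |U(w)| < ∞, then for every unit vector θ ∈ ℝ^{n+1} and every ξ ∈ ℝ^{n+1} with ⟨ξ, θ⟩ = 0, the geodesic X-ray transform satisfies |X(U)(ξ, θ)| ≤ C_m ‖U‖_{∞,m} (1 + ‖ξ‖)^{−m}. -/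
open scoped RealInnerProductSpace

/-- The geodesic X-ray transform `X(U)(ξ,θ) = -2∫_{-∞}^{-1/2} U(γ(t,ξ,θ))/(1+2t) dt`. -/
noncomputable def XrayTransform {n : ℕ} (U : EuclideanSpace ℝ (Fin (n + 1)) → ℝ)
    (ξ θ : EuclideanSpace ℝ (Fin (n + 1))) : ℝ :=
  -2 * ∫ t in Set.Iio (-(1 / 2) : ℝ), U (gammaCurve t ξ θ) / (1 + 2 * t)

open MeasureTheory Set Filter Topology

/-- Along the curve, `‖γ(t, ξ, θ)‖² = 1 + (1 + 2t)/(t² + ‖ξ‖²)`. -/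
theorem norm_gammaCurve_sq {n : ℕ} {t : ℝ} (ht : t ≠ 0) {ξ θ : EuclideanSpace ℝ (Fin (n + 1))}
    (hθ : ‖θ‖ = 1) (hξ : ⟪ξ, θ⟫ = 0) :
    ‖gammaCurve t ξ θ‖ ^ 2 = 1 + (1 + 2 * t) / (t ^ 2 + ‖ξ‖ ^ 2) := by
  have hR : t ^ 2 + ‖ξ‖ ^ 2 ≠ 0 := by positivity
  have hξ' : ⟪θ, ξ⟫ = 0 := by rw [real_inner_comm, hξ]
  rw [← real_inner_self_eq_norm_sq, gammaCurve]
  simp only [inner_add_left, inner_add_right, real_inner_smul_left, real_inner_smul_right, hξ, hξ']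
  simp only [real_inner_self_eq_norm_sq, hθ]
  field_simp
  ring

/-- Pointwise bound on the X-ray integrand: `y` plays the role of the boundary defining function
`(1 - r)/(1 + r)` at a point of norm `r` on the curve. -/
theorem rpow_div_le_of_norm_sq_eq {m t a r : ℝ} (hm : 1 ≤ m) (ht : t < -(1 / 2)) (ha : 0 ≤ a)
    (hr : 0 ≤ r) (hr1 : r < 1) (h : r ^ 2 = 1 + (1 + 2 * t) / (t ^ 2 + a ^ 2)) :
    ((1 - r) / (1 + r)) ^ m / (-(1 + 2 * t)) ≤ 8 ^ m * (a - 2 * t) ^ (-m - 1) := by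
  set y := (1 - r) / (1 + r) with hy
  set s := -(1 + 2 * t) with hs
  set V := a - 2 * t with hV
  have hs0 : 0 < s := by simp only [hs]; linarith
  have hV0 : 0 < V := by simp only [hV]; linarith
  have hy0 : 0 < y := div_pos (by linarith) (by linarith)
  have hR : 0 < t ^ 2 + a ^ 2 := by nlinarith
  have hyR : y ≤ s / (t ^ 2 + a ^ 2) := by
    have h1 : s / (t ^ 2 + a ^ 2) = 1 - r ^ 2 := by rw [h, hs]; ring
    rw [h1, hy, div_le_iff₀ (by linarith)]
    nlinarith [mul_nonneg hr (sub_nonneg.2 hr1.le), mul_nonneg (mul_nonneg hr hr)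
      (sub_nonneg.2 hr1.le)]
  have hRV : V ^ 2 ≤ 8 * (t ^ 2 + a ^ 2) := by
    simp only [hV]; nlinarith [sq_nonneg (a + 2 * t)]
  have hyV : y ≤ s * (8 / V ^ 2) := by
    refine hyR.trans ?_
    rw [← mul_div_assoc, div_le_div_iff₀ hR (by positivity)]
    nlinarith
  have hyV' : y ≤ 8 / V := by
    refine hyV.trans ?_
    rw [← mul_div_assoc, div_le_div_iff₀ (by positivity) hV0]
    have : s ≤ V := by simp only [hs, hV]; linarith
    nlinarith [mul_le_mul_of_nonneg_right this (sq_nonneg V), sq_nonneg V]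
  rw [div_le_iff₀ hs0]
  calc y ^ m = y ^ (m - 1) * y := by rw [← Real.rpow_add_one hy0.ne', sub_add_cancel]
    _ ≤ (8 / V) ^ (m - 1) * (s * (8 / V ^ 2)) := by
      gcongr
    _ = 8 ^ m * V ^ (-m - 1) * s := by
      rw [Real.div_rpow (by norm_num) hV0.le, Real.rpow_sub_one (by norm_num),
        Real.rpow_sub_one hV0.ne', Real.rpow_sub_one hV0.ne', Real.rpow_neg hV0.le]
      field_simp

theorem hasDerivAt_rpow_sub_two_mul {m a t : ℝ} (hm : m ≠ 0) (hV : 0 < a - 2 * t) :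
    HasDerivAt (fun t : ℝ => (a - 2 * t) ^ (-m) / (2 * m)) ((a - 2 * t) ^ (-m - 1)) t := by
  have h1 : HasDerivAt (fun t : ℝ => a - 2 * t) (-2) t := by
    simpa using ((hasDerivAt_id t).const_mul 2).const_sub a
  refine ((h1.rpow_const (p := -m) (Or.inl hV.ne')).div_const (2 * m)).congr_deriv ?_
  rw [div_eq_iff (by simpa using hm)]
  ring

theorem tendsto_rpow_sub_two_mul_atBot {m : ℝ} (hm : 0 < m) (a : ℝ) :
    Tendsto (fun t : ℝ => (a - 2 * t) ^ (-m) / (2 * m)) atBot (𝓝 0) := by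
  have h1 : Tendsto (fun t : ℝ => a - 2 * t) atBot atTop :=
    tendsto_atTop_add_const_left _ a
      (tendsto_neg_atBot_atTop.comp (tendsto_id.const_mul_atBot two_pos))
  simpa using ((tendsto_rpow_neg_atTop hm).comp h1).div_const (2 * m)

theorem integrableOn_Iio_rpow_sub_two_mul {m a : ℝ} (hm : 0 < m) (ha : 0 ≤ a) :
    IntegrableOn (fun t : ℝ => (a - 2 * t) ^ (-m - 1)) (Iio (-(1 / 2))) := by
  have hV : ∀ t ∈ Iic (-(1 / 2) : ℝ), 0 < a - 2 * t := fun t ht => by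
    have := mem_Iic.1 ht; linarith
  refine IntegrableOn.mono_set ?_ Iio_subset_Iic_self
  refine integrableOn_Iic_of_intervalIntegral_norm_tendsto
    ((a - 2 * -(1 / 2)) ^ (-m) / (2 * m) - 0) _ (a := id) (fun i => ?_) tendsto_id
    (((tendsto_rpow_sub_two_mul_atBot hm a).const_sub _).congr' ?_)
  · refine (ContinuousOn.integrableOn_Icc ?_).mono_set Ioc_subset_Icc_self
    exact fun t ht => ContinuousAt.continuousWithinAt <|
      (by fun_prop : ContinuousAt (fun t : ℝ => a - 2 * t) t).rpow_const (Or.inl (hV t ht.2).ne')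
  · filter_upwards [eventually_le_atBot (-(1 / 2) : ℝ)] with i hi
    have hi' : ∀ t ∈ uIcc i (-(1 / 2)), 0 < a - 2 * t := fun t ht =>
      hV t (by rw [uIcc_of_le hi] at ht; exact ht.2)
    rw [id, intervalIntegral.integral_congr (g := fun t => (a - 2 * t) ^ (-m - 1)) fun t ht =>
      Real.norm_of_nonneg (Real.rpow_nonneg (hi' t ht).le _)]
    refine (intervalIntegral.integral_eq_sub_of_hasDerivAt
      (fun t ht => hasDerivAt_rpow_sub_two_mul hm.ne' (hi' t ht)) ?_).symm
    exact ContinuousOn.intervalIntegrable fun t ht => ContinuousAt.continuousWithinAt <|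
      (by fun_prop : ContinuousAt (fun t : ℝ => a - 2 * t) t).rpow_const (Or.inl (hi' t ht).ne')

theorem integral_Iio_rpow_sub_two_mul {m a : ℝ} (hm : 0 < m) (ha : 0 ≤ a) :
    ∫ t in Iio (-(1 / 2) : ℝ), (a - 2 * t) ^ (-m - 1) = (1 + a) ^ (-m) / (2 * m) := by
  rw [← integral_Iic_eq_integral_Iio, integral_Iic_of_hasDerivAt_of_tendsto' (m := 0)
    (f := fun t : ℝ => (a - 2 * t) ^ (-m) / (2 * m))]
  · norm_num [add_comm]
  · exact fun t ht => hasDerivAt_rpow_sub_two_mul hm.ne' (by have := mem_Iic.1 ht; linarith)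
  · exact (integrableOn_Iio_rpow_sub_two_mul hm ha).congr_set_ae Iio_ae_eq_Iic.symm
  · exact tendsto_rpow_sub_two_mul_atBot hm a

/-- If `U` vanishes outside the unit ball and `x(w)^{-m}|U(w)| ≤ K` on the ball, where
`x(w) = (1-‖w‖)/(1+‖w‖)`, then `|X(U)(ξ,θ)| ≤ C_m K (1+‖ξ‖)^{-m}`, with `C_m`
independent of `U`, `K`, `ξ`, `θ`. -/
theorem stmt_8 (n : ℕ) (hn : 1 ≤ n) (m : ℝ) (hm : 1 < m) :
    ∃ C : ℝ, 0 < C ∧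
      ∀ (U : EuclideanSpace ℝ (Fin (n + 1)) → ℝ), Measurable U →
        (∀ w, 1 ≤ ‖w‖ → U w = 0) →
        ∀ K : ℝ, (∀ w : EuclideanSpace ℝ (Fin (n + 1)), ‖w‖ < 1 →
            ((1 + ‖w‖) / (1 - ‖w‖)) ^ m * |U w| ≤ K) →
        ∀ (θ ξ : EuclideanSpace ℝ (Fin (n + 1))), ‖θ‖ = 1 → ⟪ξ, θ⟫ = 0 →
          |XrayTransform U ξ θ| ≤ C * K * (1 + ‖ξ‖) ^ (-m) := by
  have hm0 : 0 < m := by linarith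
  refine ⟨8 ^ m / m, by positivity, fun U _ _ K hK θ ξ hθ hξ => ?_⟩
  have hK0 : 0 ≤ K := by
    have := hK 0 (by simp)
    simp only [norm_zero, add_zero, sub_zero] at this
    exact le_trans (by positivity) this
  have hbound : ∀ t ∈ Iio (-(1 / 2) : ℝ), ‖U (gammaCurve t ξ θ) / (1 + 2 * t)‖ ≤
      K * 8 ^ m * (‖ξ‖ - 2 * t) ^ (-m - 1) := by
    intro t ht
    have ht : t < -(1 / 2) := ht
    have hsq := norm_gammaCurve_sq (by linarith : t ≠ 0) hθ hξ
    set r := ‖gammaCurve t ξ θ‖ with hr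
    have hr0 : 0 ≤ r := norm_nonneg _
    have hR : 0 < t ^ 2 + ‖ξ‖ ^ 2 := by nlinarith [sq_nonneg ‖ξ‖]
    have hr1 : r < 1 := by
      have : (1 + 2 * t) / (t ^ 2 + ‖ξ‖ ^ 2) < 0 := div_neg_of_neg_of_pos (by linarith) hR
      nlinarith
    have hU : |U (gammaCurve t ξ θ)| ≤ K * ((1 - r) / (1 + r)) ^ m := by
      have h := hK _ hr1
      have hpos : 0 < (1 + r) / (1 - r) := div_pos (by linarith) (by linarith)
      rw [← inv_div, Real.inv_rpow hpos.le, ← div_eq_mul_inv, le_div_iff₀ (by positivity),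
        mul_comm]
      exact h
    have hs : 0 < -(1 + 2 * t) := by linarith
    rw [norm_div, Real.norm_eq_abs, Real.norm_eq_abs, abs_of_neg (by linarith : 1 + 2 * t < 0)]
    calc _ ≤ K * ((1 - r) / (1 + r)) ^ m / (-(1 + 2 * t)) := by gcongr
      _ = K * (((1 - r) / (1 + r)) ^ m / (-(1 + 2 * t))) := by rw [mul_div_assoc]
      _ ≤ K * (8 ^ m * (‖ξ‖ - 2 * t) ^ (-m - 1)) := by
        gcongr
        exact rpow_div_le_of_norm_sq_eq hm.le ht (norm_nonneg _) hr0 hr1 hsq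
      _ = _ := by ring
  have hint := norm_integral_le_of_norm_le
    ((integrableOn_Iio_rpow_sub_two_mul hm0 (norm_nonneg ξ)).const_mul (K * 8 ^ m))
    ((ae_restrict_iff' measurableSet_Iio).2 (Eventually.of_forall hbound))
  rw [integral_const_mul, integral_Iio_rpow_sub_two_mul hm0 (norm_nonneg ξ),
    Real.norm_eq_abs] at hint
  rw [XrayTransform, abs_mul, abs_neg, abs_two]
  calc _ ≤ 2 * (K * 8 ^ m * ((1 + ‖ξ‖) ^ (-m) / (2 * m))) := by gcongr
    _ = _ := by field_simp
end

section
/- Let G₁, G₂ : ℝ → ℝ be continuous functions which are nonnegative and nonincreasing on [0, ∞), tend to 0 as r → ∞, and are strictly decreasing where positive, in the sense that for i = 1, 2 and all 0 ≤ a < b, if Gᵢ(b) > 0 then Gᵢ(a) > Gᵢ(b). Suppose that for every pair of reals 0 < α < β, the Lebesgue measure of {r ≥ 0 : G₁(r) ∈ (α, β)} equals the Lebesgue measure of {r ≥ 0 : G₂(r) ∈ (α, β)}. Then G₁(r) = G₂(r) for all r ≥ 0. -/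
open MeasureTheory Filter

/-- If `f` and `g` are nonincreasing on `[0,∞)`, `f` is nonnegative, `g` is continuous, and the
preimages of each interval `(α,β) ⊂ (0,∞)` under `f` and `g` have equal measure, then `g ≤ f`. -/
theorem le_of_volume_preimage_Ioo_eq {f g : ℝ → ℝ} (hg : Continuous g)
    (hf_nonneg : ∀ r, 0 ≤ r → 0 ≤ f r)
    (hf_anti : AntitoneOn f (Set.Ici 0)) (hg_anti : AntitoneOn g (Set.Ici 0))
    (h : ∀ α β : ℝ, 0 < α → α < β →
      volume {r : ℝ | 0 ≤ r ∧ f r ∈ Set.Ioo α β} =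
        volume {r : ℝ | 0 ≤ r ∧ g r ∈ Set.Ioo α β})
    {r : ℝ} (hr : 0 ≤ r) : g r ≤ f r := by
  by_contra! hlt
  obtain ⟨α, hfα, hαg⟩ := exists_between hlt
  have hα : 0 < α := (hf_nonneg r hr).trans_lt hfα
  have hg0 : g r ≤ g 0 := hg_anti Set.self_mem_Ici hr hr
  obtain ⟨ε, hε, hball⟩ :=
    Metric.eventually_nhds_iff.1 (hg.continuousAt.eventually (lt_mem_nhds hαg))
  have hgα : α < g (r + ε / 2) := hball (by
    rw [Real.dist_eq, add_sub_cancel_left, abs_of_pos (half_pos hε)]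
    exact half_lt_self hε)
  have hf_sub : {x : ℝ | 0 ≤ x ∧ f x ∈ Set.Ioo α (g 0 + 1)} ⊆ Set.Icc 0 r := by
    rintro x ⟨hx, hαx, -⟩
    refine ⟨hx, ?_⟩
    by_contra! hrx
    exact (hαx.trans_le (hf_anti hr hx hrx.le)).not_gt hfα
  have hg_sub : Set.Icc 0 (r + ε / 2) ⊆ {x : ℝ | 0 ≤ x ∧ g x ∈ Set.Ioo α (g 0 + 1)} := by
    rintro x ⟨hx, hxr⟩
    refine ⟨hx, hgα.trans_le (hg_anti hx (hx.trans hxr) hxr), ?_⟩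
    exact (hg_anti Set.self_mem_Ici hx hx).trans_lt (lt_add_one _)
  have hle : volume (Set.Icc 0 (r + ε / 2)) ≤ volume (Set.Icc 0 r) :=
    (measure_mono hg_sub).trans ((h α (g 0 + 1) hα (by linarith)).ge.trans (measure_mono hf_sub))
  rw [Real.volume_Icc, Real.volume_Icc, ENNReal.ofReal_le_ofReal_iff (by linarith)] at hle
  linarith

/-- Two continuous, nonnegative profiles on `[0,∞)`, nonincreasing, tending to `0` at
infinity and strictly decreasing where positive, which have the same distribution of
values (the preimages of every interval `(α,β) ⊂ (0,∞)` have equal Lebesgue measure),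
must coincide on `[0,∞)`. -/
theorem stmt_14 (G₁ G₂ : ℝ → ℝ)
    (hc₁ : Continuous G₁) (hc₂ : Continuous G₂)
    (hnn₁ : ∀ r, 0 ≤ r → 0 ≤ G₁ r) (hnn₂ : ∀ r, 0 ≤ r → 0 ≤ G₂ r)
    (hmono₁ : ∀ a b : ℝ, 0 ≤ a → a ≤ b → G₁ b ≤ G₁ a)
    (hmono₂ : ∀ a b : ℝ, 0 ≤ a → a ≤ b → G₂ b ≤ G₂ a)
    (hlim₁ : Tendsto G₁ atTop (nhds 0)) (hlim₂ : Tendsto G₂ atTop (nhds 0))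
    (hstrict₁ : ∀ a b : ℝ, 0 ≤ a → a < b → 0 < G₁ b → G₁ b < G₁ a)
    (hstrict₂ : ∀ a b : ℝ, 0 ≤ a → a < b → 0 < G₂ b → G₂ b < G₂ a)
    (hmeas : ∀ α β : ℝ, 0 < α → α < β →
      volume {r : ℝ | 0 ≤ r ∧ G₁ r ∈ Set.Ioo α β} =
        volume {r : ℝ | 0 ≤ r ∧ G₂ r ∈ Set.Ioo α β}) :
    ∀ r : ℝ, 0 ≤ r → G₁ r = G₂ r := by
  intro r hr
  have hanti₁ : AntitoneOn G₁ (Set.Ici 0) := fun a ha b _ hab => hmono₁ a b ha hab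
  have hanti₂ : AntitoneOn G₂ (Set.Ici 0) := fun a ha b _ hab => hmono₂ a b ha hab
  exact le_antisymm
    (le_of_volume_preimage_Ioo_eq hc₁ hnn₂ hanti₂ hanti₁
      (fun α β hα hαβ => (hmeas α β hα hαβ).symm) hr)
    (le_of_volume_preimage_Ioo_eq hc₂ hnn₁ hanti₁ hanti₂ hmeas hr)
end

section
/- Let V : ℝ → ℝ be monotone nondecreasing, and suppose that for every r ≥ 0 the function t ↦ V(T(r, t))/(1 + 2t) is Lebesgue integrable on (−∞, −1/2). Define G_V(r) = ∫_{−∞}^{−1/2} V(T(r, t))/(1 + 2t) dt. Then G_V is nonincreasing on [0, ∞); if moreover V(ρ) ≤ 0 for all ρ, then G_V(r) ≥ 0 for all r ≥ 0. -/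
open MeasureTheory

/-- `A(t,r) = [((1+t)² + r²)/(t² + r²)]^{1/2}`. -/
noncomputable def Afun (t r : ℝ) : ℝ :=
  Real.sqrt (((1 + t) ^ 2 + r ^ 2) / (t ^ 2 + r ^ 2))

/-- `T(r,t) = log((1 + A(t,r))/(1 - A(t,r)))`. -/
noncomputable def Tfun (r t : ℝ) : ℝ :=
  Real.log ((1 + Afun t r) / (1 - Afun t r))

/-- `G_V(r) = ∫_{-∞}^{-1/2} V(T(r,t))/(1+2t) dt`. -/
noncomputable def GV (V : ℝ → ℝ) (r : ℝ) : ℝ :=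
  ∫ t in Set.Iio (-(1 / 2) : ℝ), V (Tfun r t) / (1 + 2 * t)

/-- `A` takes values below `1` on `t < -1/2`. -/
lemma Afun_lt_one {t : ℝ} (ht : t < -(1 / 2)) (r : ℝ) : Afun t r < 1 := by
  have hpos : 0 < t ^ 2 + r ^ 2 := by nlinarith [sq_nonneg r]
  rw [Afun, Real.sqrt_lt' one_pos, div_lt_iff₀ hpos]
  linarith

/-- For fixed `t < -1/2`, `A(t,r)` is nondecreasing in `r ≥ 0`. -/
lemma Afun_mono {t : ℝ} (ht : t < -(1 / 2)) {r₁ r₂ : ℝ} (h₁ : 0 ≤ r₁) (h : r₁ ≤ r₂) :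
    Afun t r₁ ≤ Afun t r₂ := by
  have hpos : ∀ r : ℝ, 0 < t ^ 2 + r ^ 2 := fun r => by nlinarith [sq_nonneg r]
  have hsq : r₁ ^ 2 ≤ r₂ ^ 2 := pow_le_pow_left₀ h₁ h 2
  refine Real.sqrt_le_sqrt ?_
  rw [div_le_div_iff₀ (hpos r₁) (hpos r₂)]
  nlinarith [mul_nonneg (sub_nonneg.2 hsq) (show 0 ≤ -(1 + 2 * t) by linarith)]

/-- For fixed `t < -1/2`, `T(r,t)` is nondecreasing in `r ≥ 0`. -/
lemma Tfun_mono {t : ℝ} (ht : t < -(1 / 2)) {r₁ r₂ : ℝ} (h₁ : 0 ≤ r₁) (h : r₁ ≤ r₂) :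
    Tfun r₁ t ≤ Tfun r₂ t := by
  have hA := Afun_mono ht h₁ h
  have hA₁ := Afun_lt_one ht r₁
  have hA₂ := Afun_lt_one ht r₂
  have h0 : 0 ≤ Afun t r₁ := Real.sqrt_nonneg _
  refine Real.log_le_log (div_pos (by linarith) (by linarith)) ?_
  exact div_le_div₀ (by linarith) (by linarith) (by linarith) (by linarith)

/-- If `V` is nondecreasing and the defining integrals converge, then `G_V` is
nonincreasing on `[0,∞)`; if moreover `V ≤ 0` then `G_V ≥ 0` on `[0,∞)`. -/
theorem stmt_16 (V : ℝ → ℝ) (hV : Monotone V)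
    (hint : ∀ r : ℝ, 0 ≤ r →
      IntegrableOn (fun t => V (Tfun r t) / (1 + 2 * t)) (Set.Iio (-(1 / 2) : ℝ))) :
    (∀ r₁ r₂ : ℝ, 0 ≤ r₁ → r₁ ≤ r₂ → GV V r₂ ≤ GV V r₁) ∧
    ((∀ ρ : ℝ, V ρ ≤ 0) → ∀ r : ℝ, 0 ≤ r → 0 ≤ GV V r) := by
  refine ⟨fun r₁ r₂ h₁ h => ?_, fun hneg r _ => ?_⟩
  · refine setIntegral_mono_on (hint r₂ (h₁.trans h)) (hint r₁ h₁) measurableSet_Iio ?_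
    intro t ht
    exact div_le_div_of_nonpos_of_le (by linarith [Set.mem_Iio.1 ht]) (hV (Tfun_mono ht h₁ h))
  · refine setIntegral_nonneg measurableSet_Iio fun t ht => ?_
    exact div_nonneg_of_nonpos (hneg _) (by linarith [Set.mem_Iio.1 ht])
end

section
/- Let n ≥ 1 be an integer and let m > n be a real number. There exists a constant C_m > 0 such that for every unit vector θ ∈ ℝ^{n+1}, ∫_{‖w‖<1} ((1 − ‖w‖²)^n / ‖w − θ‖^{2n}) · ((1 − ‖w‖)/(1 + ‖w‖))^{2m} · (1 − ‖w‖²)^{−(n+1)} dw ≤ C_m, where dw is Lebesgue measure on the open unit ball of ℝ^{n+1}. In particular, the square of the Poisson kernel (1 − ‖w‖²)^s/‖w − θ‖^{2s} with Re s = n/2, weighted by x(w)^{2m} and integrated against the hyperbolic volume density (1 − ‖w‖²)^{−(n+1)}, is finite uniformly in θ. -/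
open MeasureTheory

/-- A power `(1 - ‖w‖) ^ a` with `a > -1` is integrable over the open unit ball. -/
lemma integrableOn_ball_one_sub_norm_rpow {E : Type*} [NormedAddCommGroup E] [NormedSpace ℝ E]
    [FiniteDimensional ℝ E] [Nontrivial E] [MeasurableSpace E] [BorelSpace E]
    (μ : Measure E) [μ.IsAddHaarMeasure] {a : ℝ} (ha : -1 < a) :
    IntegrableOn (fun w : E => (1 - ‖w‖) ^ a) (Metric.ball 0 1) μ := by
  refine (integrableOn_fun_norm_addHaar μ (f := fun y : ℝ => (1 - y) ^ a)).2 ?_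
  have hpow : IntervalIntegrable (fun y : ℝ => (1 - y) ^ a) volume 0 1 := by
    have h := (intervalIntegral.intervalIntegrable_rpow' (a := 0) (b := 1) ha).comp_sub_left 1
    simpa using h.symm
  rw [intervalIntegrable_iff_integrableOn_Ioo_of_le zero_le_one] at hpow
  simp only [smul_eq_mul]
  refine Integrable.bdd_mul (c := 1) hpow (by fun_prop) ?_
  filter_upwards [ae_restrict_mem measurableSet_Ioo] with y hy
  rw [Real.norm_of_nonneg (pow_nonneg hy.1.le _)]
  exact pow_le_one₀ hy.1.le hy.2.le

/-- The weighted squared Poisson kernel at distance `d ≥ 1 - r` from the boundary point is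
dominated by a power of `1 - r`. -/
lemma weighted_poisson_kernel_le {k m r d : ℝ} (hk : 0 ≤ k) (hm : 0 ≤ m) (hr : 0 ≤ r)
    (hr1 : r < 1) (hd : 1 - r ≤ d) :
    (1 - r ^ 2) ^ k / d ^ (2 * k) * ((1 - r) / (1 + r)) ^ (2 * m) * (1 - r ^ 2) ^ (-(k + 1))
      ≤ (1 - r) ^ (2 * (m - k) - 1) := by
  have ht : 0 < 1 - r := sub_pos.2 hr1
  have htu : 1 - r ≤ 1 - r ^ 2 := by nlinarith
  have hu : 0 < 1 - r ^ 2 := ht.trans_le htu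
  have hcancel : (1 - r ^ 2) ^ k * (1 - r ^ 2) ^ (-(k + 1)) = (1 - r ^ 2)⁻¹ := by
    rw [← Real.rpow_add hu, ← Real.rpow_neg_one]
    ring_nf
  have hx : (1 - r) / (1 + r) ≤ 1 - r := div_le_self ht.le (by linarith)
  have hx0 : 0 ≤ (1 - r) / (1 + r) := by positivity
  calc (1 - r ^ 2) ^ k / d ^ (2 * k) * ((1 - r) / (1 + r)) ^ (2 * m)
        * (1 - r ^ 2) ^ (-(k + 1))
      = ((1 - r ^ 2) ^ k * (1 - r ^ 2) ^ (-(k + 1))) * ((1 - r) / (1 + r)) ^ (2 * m)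
          / d ^ (2 * k) := by ring
    _ = (1 - r ^ 2)⁻¹ * ((1 - r) / (1 + r)) ^ (2 * m) / d ^ (2 * k) := by rw [hcancel]
    _ ≤ (1 - r)⁻¹ * (1 - r) ^ (2 * m) / (1 - r) ^ (2 * k) := by gcongr
    _ = (1 - r) ^ (2 * (m - k) - 1) := by
      rw [← Real.rpow_neg_one, ← Real.rpow_add ht, ← Real.rpow_sub ht]
      ring_nf

/-- The square of the Poisson kernel at `Re s = n/2`, weighted by `x(w)^{2m}` with
`x(w) = (1-‖w‖)/(1+‖w‖)` and integrated against the hyperbolic volume density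
`(1-‖w‖²)^{-(n+1)}` over the unit ball, is bounded uniformly in the boundary point `θ`,
provided `m > n`. -/
theorem stmt_19 (n : ℕ) (hn : 1 ≤ n) (m : ℝ) (hm : (n : ℝ) < m) :
    ∃ C : ℝ, 0 < C ∧
      ∀ θ : EuclideanSpace ℝ (Fin (n + 1)), ‖θ‖ = 1 →
        (∫ w in Metric.ball (0 : EuclideanSpace ℝ (Fin (n + 1))) 1,
            (1 - ‖w‖ ^ 2) ^ (n : ℝ) / ‖w - θ‖ ^ (2 * (n : ℝ)) *
              ((1 - ‖w‖) / (1 + ‖w‖)) ^ (2 * m) *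
              (1 - ‖w‖ ^ 2) ^ (-((n : ℝ) + 1))) ≤ C := by
  have hn0 : (0 : ℝ) ≤ n := n.cast_nonneg
  refine ⟨|∫ w in Metric.ball (0 : EuclideanSpace ℝ (Fin (n + 1))) 1,
    (1 - ‖w‖) ^ (2 * (m - n) - 1)| + 1, by positivity, fun θ hθ => ?_⟩
  refine le_trans ?_ ((le_abs_self _).trans (le_add_of_nonneg_right zero_le_one))
  refine integral_mono_of_nonneg ?_
    (integrableOn_ball_one_sub_norm_rpow volume (by linarith)) ?_
  · filter_upwards [ae_restrict_mem measurableSet_ball] with w hw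
    have hw1 : ‖w‖ < 1 := mem_ball_zero_iff.1 hw
    have ht : 0 ≤ 1 - ‖w‖ := sub_nonneg.2 hw1.le
    have hu : 0 ≤ 1 - ‖w‖ ^ 2 := by nlinarith [norm_nonneg w]
    simp only [Pi.zero_apply]
    positivity
  · filter_upwards [ae_restrict_mem measurableSet_ball] with w hw
    refine weighted_poisson_kernel_le hn0 (hn0.trans hm.le) (norm_nonneg w)
      (mem_ball_zero_iff.1 hw) ?_
    rw [← hθ, norm_sub_rev w θ]
    exact norm_sub_norm_le θ w
end
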